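/- arXiv:2201.06530 — 2 statements merged into one kernel-verified Lean document; each statement's English description precedes it below -/
import Mathlib

section
/- Let S be a Λ-Carleson collection of dyadic cubes in R^n with no infinitely increasing chains. Then b_S := Σ_{Q∈S} 1_Q belongs to dyadic BMO with ‖b_S‖_{BMO^D} ≤ Λ, i.e., for every dyadic cube Q_0, (1/|Q_0|) ∫_{Q_0} |b_S − ⟨b_S⟩_{Q_0}| dx ≤ Λ. -/
open MeasureTheory

/-- A dyadic cube in `ℝⁿ` (standard dyadic grid). -/
structure DyadicCube (n : ℕ) where
  k : ℤ
  m : Fin n → ℤ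

/-- The set of points of a dyadic cube. -/
def DyadicCube.toSet {n : ℕ} (Q : DyadicCube n) : Set (Fin n → ℝ) :=
  {x | ∀ i, (Q.m i : ℝ) * 2 ^ Q.k ≤ x i ∧ x i < ((Q.m i : ℝ) + 1) * 2 ^ Q.k}

/-- Lebesgue measure of a dyadic cube, as a real number. -/
noncomputable def DyadicCube.vol {n : ℕ} (Q : DyadicCube n) : ℝ :=
  (volume Q.toSet).toReal

/-- `S` is `Λ`-Carleson (phrased via finite subfamilies). -/
def IsCarleson {n : ℕ} (Λ : ℝ) (S : Set (DyadicCube n)) : Prop :=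
  ∀ Q : DyadicCube n, ∀ F : Finset (DyadicCube n),
    (∀ P ∈ F, P ∈ S ∧ P.toSet ⊆ Q.toSet) → ∑ P ∈ F, P.vol ≤ Λ * Q.vol

/-- The sparse BMO function `b_S = Σ_{Q ∈ S} 1_Q`. -/
noncomputable def bS {n : ℕ} (S : Set (DyadicCube n)) : (Fin n → ℝ) → ℝ :=
  fun x => ∑' Q : S, Set.indicator (Q : DyadicCube n).toSet (fun _ => (1 : ℝ)) x

namespace DyadicCube

variable {n : ℕ}

instance : Countable (DyadicCube n) :=
  Function.Injective.countable (f := fun Q : DyadicCube n => (Q.k, Q.m)) <| by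
    rintro ⟨k, m⟩ ⟨k', m'⟩ h
    simpa using h

lemma toSet_eq_pi (Q : DyadicCube n) :
    Q.toSet = Set.univ.pi fun i => Set.Ico ((Q.m i : ℝ) * 2 ^ Q.k) (((Q.m i : ℝ) + 1) * 2 ^ Q.k) := by
  ext x
  simp [toSet]

lemma measurableSet_toSet (Q : DyadicCube n) : MeasurableSet Q.toSet := by
  rw [toSet_eq_pi]
  exact MeasurableSet.univ_pi fun _ => measurableSet_Ico

lemma volume_toSet_ne_top (Q : DyadicCube n) : volume Q.toSet ≠ ⊤ := by
  rw [toSet_eq_pi, Real.volume_pi_Ico]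
  exact ENNReal.prod_ne_top fun _ _ => ENNReal.ofReal_ne_top

lemma ofReal_vol (Q : DyadicCube n) : ENNReal.ofReal Q.vol = volume Q.toSet :=
  ENNReal.ofReal_toReal Q.volume_toSet_ne_top

lemma toSet_subset_of_le {P Q : DyadicCube n} (h : P.k ≤ Q.k) {x : Fin n → ℝ}
    (hP : x ∈ P.toSet) (hQ : x ∈ Q.toSet) : P.toSet ⊆ Q.toSet := by
  obtain ⟨d, hd⟩ := Int.le.dest h
  have hu : (0 : ℝ) < 2 ^ P.k := by positivity
  have hk : (2 : ℝ) ^ Q.k = ((2 ^ d : ℤ) : ℝ) * 2 ^ P.k := by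
    rw [← hd, zpow_add₀ two_ne_zero]
    push_cast
    rw [zpow_natCast, mul_comm]
  intro y hy i
  have hPi := hP i
  have hQi := hQ i
  have hyi := hy i
  rw [hk] at hQi ⊢
  rw [← mul_assoc, ← mul_assoc] at hQi ⊢
  have h₁ : Q.m i * 2 ^ d ≤ P.m i := by
    have := lt_of_mul_lt_mul_right (hQi.1.trans_lt hPi.2) hu.le
    exact Int.lt_add_one_iff.mp (by exact_mod_cast this)
  have h₂ : P.m i + 1 ≤ (Q.m i + 1) * 2 ^ d := by
    have := lt_of_mul_lt_mul_right (hPi.1.trans_lt hQi.2) hu.le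
    exact Int.add_one_le_iff.mpr (by exact_mod_cast this)
  have h₁' : (Q.m i : ℝ) * (2 ^ d : ℤ) ≤ P.m i := by exact_mod_cast h₁
  have h₂' : (P.m i : ℝ) + 1 ≤ (Q.m i + 1) * (2 ^ d : ℤ) := by exact_mod_cast h₂
  exact ⟨(mul_le_mul_of_nonneg_right h₁' hu.le).trans hyi.1,
    hyi.2.trans_le (mul_le_mul_of_nonneg_right h₂' hu.le)⟩

lemma subset_or_subset_of_mem {P Q : DyadicCube n} {x : Fin n → ℝ}
    (hP : x ∈ P.toSet) (hQ : x ∈ Q.toSet) : P.toSet ⊆ Q.toSet ∨ Q.toSet ⊆ P.toSet :=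
  (le_total P.k Q.k).imp (toSet_subset_of_le · hP hQ) (toSet_subset_of_le · hQ hP)

end DyadicCube

section LocalCounting

open scoped Classical ENNReal
open DyadicCube

variable {n : ℕ} {S : Set (DyadicCube n)} {Λ : ℝ}

/-- The volume of `P` if `P` belongs to `S` and is contained in `Q`, and zero otherwise. -/
noncomputable def subVolume (S : Set (DyadicCube n)) (Q P : DyadicCube n) : ℝ≥0∞ :=
  if P ∈ S ∧ P.toSet ⊆ Q.toSet then volume P.toSet else 0

/-- The indicator of `P` if `P` belongs to `S` and is contained in `Q`, and zero otherwise. -/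
noncomputable def subIndicator (S : Set (DyadicCube n)) (Q P : DyadicCube n) :
    (Fin n → ℝ) → ℝ≥0∞ :=
  if P ∈ S ∧ P.toSet ⊆ Q.toSet then P.toSet.indicator 1 else 0

/-- The number of cubes of `S` contained in `Q` and containing a given point. -/
noncomputable def localCount (S : Set (DyadicCube n)) (Q : DyadicCube n) (x : Fin n → ℝ) : ℝ≥0∞ :=
  ∑' P, subIndicator S Q P x

lemma measurable_subIndicator (S : Set (DyadicCube n)) (Q P : DyadicCube n) :
    Measurable (subIndicator S Q P) := by
  unfold subIndicator
  split_ifs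
  · exact measurable_one.indicator P.measurableSet_toSet
  · exact measurable_zero

lemma measurable_localCount (S : Set (DyadicCube n)) (Q : DyadicCube n) :
    Measurable (localCount S Q) :=
  Measurable.tsum (measurable_subIndicator S Q)

lemma IsCarleson.tsum_subVolume_le (h : IsCarleson Λ S) (hΛ : 0 ≤ Λ) (Q : DyadicCube n) :
    ∑' P, subVolume S Q P ≤ ENNReal.ofReal Λ * volume Q.toSet := by
  rw [ENNReal.tsum_eq_iSup_sum]
  refine iSup_le fun F => ?_
  have hF := h Q (F.filter fun P => P ∈ S ∧ P.toSet ⊆ Q.toSet)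
    fun P hP => (Finset.mem_filter.mp hP).2
  simp only [subVolume]
  rw [← Finset.sum_filter, ← ofReal_vol Q, ← ENNReal.ofReal_mul hΛ]
  simp only [← ofReal_vol]
  rw [← ENNReal.ofReal_sum_of_nonneg (f := DyadicCube.vol) fun _ _ => ENNReal.toReal_nonneg]
  exact ENNReal.ofReal_le_ofReal hF

lemma setLIntegral_subIndicator (S : Set (DyadicCube n)) (Q P : DyadicCube n) :
    ∫⁻ x in Q.toSet, subIndicator S Q P x = subVolume S Q P := by
  unfold subIndicator subVolume
  split_ifs with h
  · rw [lintegral_indicator_one P.measurableSet_toSet,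
      Measure.restrict_apply P.measurableSet_toSet, Set.inter_eq_left.mpr h.2]
  · simp

lemma setLIntegral_localCount (S : Set (DyadicCube n)) (Q : DyadicCube n) :
    ∫⁻ x in Q.toSet, localCount S Q x = ∑' P, subVolume S Q P := by
  unfold localCount
  rw [lintegral_tsum fun P => (measurable_subIndicator S Q P).aemeasurable]
  simp only [setLIntegral_subIndicator]

lemma setLIntegral_subIndicator_mul_le (S : Set (DyadicCube n)) (Q P P' : DyadicCube n) :
    ∫⁻ x in Q.toSet, subIndicator S Q P x * subIndicator S Q P' x ≤
      (if P ∈ S ∧ P.toSet ⊆ Q.toSet then subVolume S P P' else 0) +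
        if P' ∈ S ∧ P'.toSet ⊆ Q.toSet then subVolume S P' P else 0 := by
  by_cases hP : P ∈ S ∧ P.toSet ⊆ Q.toSet
  swap
  · simp [subIndicator, hP]
  by_cases hP' : P' ∈ S ∧ P'.toSet ⊆ Q.toSet
  swap
  · simp [subIndicator, hP']
  have hint : ∫⁻ x in Q.toSet, subIndicator S Q P x * subIndicator S Q P' x ≤
      volume (P.toSet ∩ P'.toSet) := by
    simp only [subIndicator, if_pos hP, if_pos hP']
    simp_rw [← Set.inter_indicator_mul]
    simp only [Pi.one_apply, mul_one]
    refine (lintegral_indicator_const_le _ _).trans ?_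
    rw [one_mul]
    exact Measure.restrict_apply_le _ _
  refine hint.trans ?_
  rw [if_pos hP, if_pos hP']
  rcases (P.toSet ∩ P'.toSet).eq_empty_or_nonempty with h | ⟨x, hx, hx'⟩
  · simp [h]
  rcases subset_or_subset_of_mem hx hx' with h | h
  · refine le_add_left ?_
    rw [subVolume, if_pos ⟨hP.1, h⟩]
    exact measure_mono Set.inter_subset_left
  · refine le_add_right ?_
    rw [subVolume, if_pos ⟨hP'.1, h⟩]
    exact measure_mono Set.inter_subset_right

lemma IsCarleson.setLIntegral_localCount_mul_self_le (h : IsCarleson Λ S) (hΛ : 0 ≤ Λ)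
    (Q : DyadicCube n) :
    ∫⁻ x in Q.toSet, localCount S Q x * localCount S Q x ≤
      2 * ENNReal.ofReal Λ * ∑' P, subVolume S Q P := by
  have hsum : ∑' P, ∑' P', (if P ∈ S ∧ P.toSet ⊆ Q.toSet then subVolume S P P' else 0) ≤
      ENNReal.ofReal Λ * ∑' P, subVolume S Q P := by
    rw [← ENNReal.tsum_mul_left]
    refine ENNReal.tsum_le_tsum fun P => ?_
    by_cases hP : P ∈ S ∧ P.toSet ⊆ Q.toSet
    · simpa [hP, subVolume] using h.tsum_subVolume_le hΛ P
    · simp [hP]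
  calc ∫⁻ x in Q.toSet, localCount S Q x * localCount S Q x
      = ∑' P, ∑' P', ∫⁻ x in Q.toSet, subIndicator S Q P x * subIndicator S Q P' x := by
        have hm := measurable_subIndicator S Q
        simp only [localCount, ← ENNReal.tsum_mul_right]
        rw [lintegral_tsum fun P => (Measurable.fun_mul (hm P) (Measurable.tsum hm)).aemeasurable]
        congr 1 with P
        simp only [← ENNReal.tsum_mul_left]
        rw [lintegral_tsum fun P' => (Measurable.fun_mul (hm P) (hm P')).aemeasurable]
    _ ≤ ∑' P, ∑' P', ((if P ∈ S ∧ P.toSet ⊆ Q.toSet then subVolume S P P' else 0) +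
          if P' ∈ S ∧ P'.toSet ⊆ Q.toSet then subVolume S P' P else 0) :=
        ENNReal.tsum_le_tsum fun P => ENNReal.tsum_le_tsum fun P' =>
          setLIntegral_subIndicator_mul_le S Q P P'
    _ ≤ ENNReal.ofReal Λ * ∑' P, subVolume S Q P +
          ENNReal.ofReal Λ * ∑' P, subVolume S Q P := by
        simp only [ENNReal.tsum_add]
        refine add_le_add hsum ?_
        rw [ENNReal.tsum_comm]
        exact hsum
    _ = 2 * ENNReal.ofReal Λ * ∑' P, subVolume S Q P := by ring

lemma exists_bS_eq_toReal_add_localCount (S : Set (DyadicCube n)) (Q : DyadicCube n) :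
    ∃ c : ℝ≥0∞, ∀ x ∈ Q.toSet, bS S x = (c + localCount S Q x).toReal := by
  refine ⟨∑' P : DyadicCube n,
    if P ∈ S ∧ ¬ P.toSet ⊆ Q.toSet ∧ Q.toSet ⊆ P.toSet then 1 else 0, fun x hx => ?_⟩
  have hb : bS S x = (∑' P : S, (P : DyadicCube n).toSet.indicator (1 : (Fin n → ℝ) → ℝ≥0∞) x).toReal := by
    rw [ENNReal.tsum_toReal_eq fun P => by
      by_cases hP : x ∈ (P : DyadicCube n).toSet <;> simp [hP]]
    unfold bS
    congr 1 with P
    by_cases hP : x ∈ (P : DyadicCube n).toSet <;> simp [hP]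
  rw [hb, tsum_subtype S fun P => P.toSet.indicator (1 : (Fin n → ℝ) → ℝ≥0∞) x, localCount,
    ← ENNReal.tsum_add]
  congr 2 with P
  by_cases hS : P ∈ S
  swap
  · simp [subIndicator, hS]
  by_cases hPQ : P.toSet ⊆ Q.toSet
  · simp [subIndicator, hS, hPQ]
  by_cases hxP : x ∈ P.toSet
  · have := (subset_or_subset_of_mem hxP hx).resolve_left hPQ
    simp [subIndicator, hS, hPQ, hxP, this]
  · have : ¬ Q.toSet ⊆ P.toSet := fun h => hxP (h hx)
    simp [subIndicator, hS, hPQ, hxP, this]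

end LocalCounting

/-- A function whose second moment is at most `2Λ` times its first moment has mean oscillation
at most `Λ`. -/
lemma integral_abs_sub_average_le {α : Type*} [MeasurableSpace α] {μ : Measure α}
    [IsFiniteMeasure μ] {g : α → ℝ} {Λ : ℝ} (hΛ : 0 < Λ) (hg : MemLp g 2 μ)
    (hsq : ∫ x, g x ^ 2 ∂μ ≤ 2 * Λ * ∫ x, g x ∂μ) :
    (∫ x, |g x - (∫ y, g y ∂μ) / μ.real Set.univ| ∂μ) / μ.real Set.univ ≤ Λ := by
  set V := μ.real Set.univ with hV
  have hV0 : 0 ≤ V := measureReal_nonneg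
  rcases hV0.eq_or_lt with h0 | hpos
  · rw [← h0, div_zero]
    exact hΛ.le
  set a := (∫ y, g y ∂μ) / V with ha
  have haV : ∫ y, g y ∂μ = a * V := by rw [ha, div_mul_cancel₀ _ hpos.ne']
  have hgi : Integrable g μ := hg.integrable one_le_two
  have hg2 : Integrable (fun x => g x ^ 2) μ := hg.integrable_sq
  have hvar : ∫ x, (g x - a) ^ 2 + Λ ^ 2 ∂μ = ∫ x, g x ^ 2 ∂μ - a ^ 2 * V + Λ ^ 2 * V := by
    have : ∀ x, (g x - a) ^ 2 + Λ ^ 2 = g x ^ 2 - (2 * a) * g x + (a ^ 2 + Λ ^ 2) :=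
      fun x => by ring
    simp only [this]
    rw [integral_add (f := fun x => g x ^ 2 - 2 * a * g x) (hg2.sub (hgi.const_mul _)) (integrable_const _),
      integral_sub hg2 (hgi.const_mul _), integral_const_mul, integral_const, haV, smul_eq_mul,
      ← hV]
    ring
  have hle : ∫ x, 2 * Λ * |g x - a| ∂μ ≤ ∫ x, (g x - a) ^ 2 + Λ ^ 2 ∂μ := by
    refine integral_mono ((hgi.sub (integrable_const a)).abs.const_mul _)
      (((hg.sub (memLp_const a)).integrable_sq).add (integrable_const _)) fun x => ?_
    have := sq_nonneg (|g x - a| - Λ)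
    simp only
    rw [← sq_abs (g x - a)]
    linarith
  rw [integral_const_mul, hvar] at hle
  rw [haV] at hsq
  rw [div_le_iff₀ hpos]
  have : 0 ≤ (a - Λ) ^ 2 * V := by positivity
  refine le_of_mul_le_mul_left ?_ (mul_pos two_pos hΛ)
  linarith

/-- For a `Λ`-Carleson collection `S` of dyadic cubes with no infinitely increasing
chains, `b_S = Σ_{Q∈S} 1_Q` is in dyadic BMO with norm at most `Λ`: for every dyadic
cube `Q₀`, `(1/|Q₀|) ∫_{Q₀} |b_S − ⟨b_S⟩_{Q₀}| ≤ Λ`. -/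
theorem stmt7 {n : ℕ} (S : Set (DyadicCube n)) (Λ : ℝ) (hΛ : 1 < Λ)
    (hCar : IsCarleson Λ S)
    (hno : ¬ ∃ f : ℕ → DyadicCube n, (∀ i, f i ∈ S) ∧
      ∀ i, (f i).toSet ⊂ (f (i + 1)).toSet) :
    ∀ Q₀ : DyadicCube n,
      (∫ x in Q₀.toSet, |bS S x - (∫ y in Q₀.toSet, bS S y) / Q₀.vol|) / Q₀.vol ≤ Λ := by
  intro Q
  have hΛ0 : 0 < Λ := one_pos.trans hΛ
  obtain ⟨c, hc⟩ := exists_bS_eq_toReal_add_localCount S Q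
  by_cases hctop : c = ⊤
  · have h0 : ∀ x ∈ Q.toSet, bS S x = 0 := fun x hx => by simp [hc x hx, hctop]
    rw [setIntegral_congr_fun Q.measurableSet_toSet h0]
    rw [setIntegral_congr_fun (g := fun _ => (0 : ℝ)) Q.measurableSet_toSet
      fun x hx => by simp [h0 x hx]]
    simpa using hΛ0.le
  set μ := volume.restrict Q.toSet with hμ
  have : IsFiniteMeasure μ := ⟨by simpa [hμ] using Q.volume_toSet_ne_top.lt_top⟩
  have hμQ : μ.real Set.univ = Q.vol := by simp [hμ, Measure.real, DyadicCube.vol]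
  set G := localCount S Q with hG
  have hGm : Measurable G := measurable_localCount S Q
  have hG1 : ∫⁻ x, G x ∂μ = ∑' P, subVolume S Q P := setLIntegral_localCount S Q
  have hG1top : ∫⁻ x, G x ∂μ ≠ ⊤ := by
    rw [hG1]
    exact ne_top_of_le_ne_top (ENNReal.mul_ne_top ENNReal.ofReal_ne_top Q.volume_toSet_ne_top)
      (hCar.tsum_subVolume_le hΛ0.le Q)
  have hG2 : ∫⁻ x, G x * G x ∂μ ≤ 2 * ENNReal.ofReal Λ * ∫⁻ x, G x ∂μ := by
    rw [hG1]
    exact hCar.setLIntegral_localCount_mul_self_le hΛ0.le Q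
  have hbound : 2 * ENNReal.ofReal Λ * ∫⁻ x, G x ∂μ ≠ ⊤ :=
    ENNReal.mul_ne_top (ENNReal.mul_ne_top ENNReal.ofNat_ne_top ENNReal.ofReal_ne_top) hG1top
  have hfin : ∀ᵐ x ∂μ, G x < ⊤ := ae_lt_top hGm hG1top
  have hGGfin : ∀ᵐ x ∂μ, G x * G x < ⊤ :=
    hfin.mono fun x hx => ENNReal.mul_lt_top hx hx
  have hsq : ∀ x, (G x).toReal ^ 2 = (G x * G x).toReal := fun x => by
    rw [ENNReal.toReal_mul, sq]
  have hLp : MemLp (fun x => (G x).toReal) 2 μ := by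
    rw [memLp_two_iff_integrable_sq hGm.ennreal_toReal.aestronglyMeasurable]
    simp only [hsq]
    exact integrable_toReal_of_lintegral_ne_top (hGm.fun_mul hGm).aemeasurable
      (ne_top_of_le_ne_top hbound hG2)
  have hmom : ∫ x, (G x).toReal ^ 2 ∂μ ≤ 2 * Λ * ∫ x, (G x).toReal ∂μ := by
    simp only [hsq]
    rw [integral_toReal (hGm.fun_mul hGm).aemeasurable hGGfin,
      integral_toReal hGm.aemeasurable hfin]
    have := ENNReal.toReal_mono hbound hG2
    simpa [ENNReal.toReal_mul, ENNReal.toReal_ofReal hΛ0.le] using this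
  have hb : ∀ᵐ x ∂μ, bS S x = c.toReal + (G x).toReal := by
    filter_upwards [hfin, ae_restrict_mem Q.measurableSet_toSet] with x hx hxQ
    rw [hc x hxQ, ENNReal.toReal_add hctop hx.ne]
  have hosc := integral_abs_sub_average_le hΛ0 hLp hmom
  rw [hμQ] at hosc
  rcases eq_or_ne Q.vol 0 with h0 | h0
  · rw [h0, div_zero]
    exact hΛ0.le
  have havg : (∫ x, bS S x ∂μ) / Q.vol = c.toReal + (∫ x, (G x).toReal ∂μ) / Q.vol := by
    rw [integral_congr_ae hb,
      integral_add (integrable_const _) (hLp.integrable one_le_two), integral_const, hμQ,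
      smul_eq_mul, add_div, mul_div_cancel_left₀ _ h0]
  rw [havg]
  refine le_of_eq_of_le ?_ hosc
  congr 1
  refine integral_congr_ae (hb.mono fun x hx => ?_)
  simp only [hx, add_sub_add_left_eq_sub]
end

section
/- Let μ, λ ∈ A_p^D (1 < p < ∞) on R^n, ν := μ^{1/p} λ^{−1/p}, and let S be a 1/Λ-sparse collection of dyadic cubes. Then the Bloom sparse operator A_S^ν f := Σ_{Q∈S} ⟨ν⟩_Q ⟨f⟩_Q 1_Q is bounded L^p(μ) → L^p(λ) with norm at most Λ^{p'+p−2} p p' [μ]_{A_p}^{1/(p−1)} [λ]_{A_p}. -/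
open MeasureTheory
open scoped ENNReal

/-- Lebesgue average over a dyadic cube. -/
noncomputable def davg {n : ℕ} (f : (Fin n → ℝ) → ℝ) (Q : DyadicCube n) : ℝ :=
  (∫ x in Q.toSet, f x) / Q.vol

/-- The Bloom sparse operator `A_S^ν f = Σ_{Q∈S} ⟨ν⟩_Q ⟨f⟩_Q 1_Q`. -/
noncomputable def bloomSparseOp {n : ℕ} (S : Set (DyadicCube n))
    (ν f : (Fin n → ℝ) → ℝ) : (Fin n → ℝ) → ℝ :=
  fun x => ∑' Q : S, davg ν (Q : DyadicCube n) * davg f (Q : DyadicCube n) *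
    Set.indicator (Q : DyadicCube n).toSet (fun _ => (1 : ℝ)) x

open scoped NNReal

theorem mul_measure_biUnion_le_of_nested {ι α : Type*} [MeasurableSpace α] (ρ τ : Measure α)
    {Q : ι → Set α} (hQ : ∀ i, MeasurableSet (Q i))
    (hnest : ∀ i j, Q i ⊆ Q j ∨ Q j ⊆ Q i ∨ Disjoint (Q i) (Q j)) (t : ℝ≥0∞) (G : Finset ι)
    (h : ∀ i ∈ G, t * ρ (Q i) ≤ τ (Q i)) :
    t * ρ (⋃ i ∈ G, Q i) ≤ τ (⋃ i ∈ G, Q i) := by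
  classical
  induction G using Finset.strongInduction with
  | H G ih =>
    rcases G.eq_empty_or_nonempty with rfl | hne
    · simp
    obtain ⟨i, hi⟩ := Set.Finite.exists_maximalFor Q G G.finite_toSet hne
    have hiG : i ∈ G := hi.1
    set G' := G.filter (fun j => ¬ Q j ⊆ Q i) with hG'
    have hdisj : ∀ j ∈ G', Disjoint (Q i) (Q j) := by
      intro j hj
      rw [hG', Finset.mem_filter] at hj
      rcases hnest i j with hij | hji | hd
      · exact absurd (hi.2 (Finset.mem_coe.2 hj.1) hij) hj.2
      · exact absurd hji hj.2
      · exact hd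
    have hss : G' ⊂ G := by
      refine Finset.filter_ssubset.2 ⟨i, hiG, ?_⟩
      simp
    have hU : (⋃ j ∈ G, Q j) = Q i ∪ ⋃ j ∈ G', Q j := by
      ext x
      simp only [Set.mem_iUnion, Set.mem_union, hG', Finset.mem_filter, exists_prop]
      constructor
      · rintro ⟨j, hj, hx⟩
        by_cases hji : Q j ⊆ Q i
        · exact Or.inl (hji hx)
        · exact Or.inr ⟨j, ⟨hj, hji⟩, hx⟩
      · rintro (hx | ⟨j, ⟨hj, -⟩, hx⟩)
        · exact ⟨i, hiG, hx⟩
        · exact ⟨j, hj, hx⟩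
    have hd : Disjoint (Q i) (⋃ j ∈ G', Q j) := by
      simpa only [Set.disjoint_iUnion_right] using hdisj
    have hm : MeasurableSet (⋃ j ∈ G', Q j) := Finset.measurableSet_biUnion _ fun j _ => hQ j
    rw [hU, measure_union hd hm, measure_union hd hm, mul_add]
    exact add_le_add (h i hiG) (ih G' hss fun j hj => h j (Finset.mem_of_mem_filter j hj))

/-- The maximal function of a finite family of sets `Q i` carrying the values `c i`. -/
noncomputable def finsetMaximal {ι α : Type*} (F : Finset ι) (Q : ι → Set α) (c : ι → ℝ≥0) (x : α) :
    ℝ≥0 :=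
  F.sup fun i => (Q i).indicator (fun _ => c i) x

theorem measurable_finsetMaximal {ι α : Type*} [MeasurableSpace α] (F : Finset ι) {Q : ι → Set α}
    (hQ : ∀ i, MeasurableSet (Q i)) (c : ι → ℝ≥0) : Measurable (finsetMaximal F Q c) := by
  classical
  have h : finsetMaximal F Q c = F.sup fun i => (Q i).indicator fun _ => c i := by
    ext x
    simp [finsetMaximal, Finset.sup_apply]
  rw [h]
  exact Finset.sup_induction measurable_const (fun _ hf _ hg => hf.sup hg)
    fun i _ => measurable_const.indicator (hQ i)

theorem le_finsetMaximal {ι α : Type*} {F : Finset ι} {Q : ι → Set α} {c : ι → ℝ≥0} {i : ι}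
    (hi : i ∈ F) {x : α} (hx : x ∈ Q i) : c i ≤ finsetMaximal F Q c x := by
  have := Finset.le_sup (f := fun i => (Q i).indicator (fun _ => c i) x) hi
  rwa [Set.indicator_of_mem hx] at this

theorem mul_measure_lt_finsetMaximal_le {ι α : Type*} [MeasurableSpace α] (ρ τ : Measure α)
    {F : Finset ι} {Q : ι → Set α} (hQ : ∀ i, MeasurableSet (Q i))
    (hnest : ∀ i j, Q i ⊆ Q j ∨ Q j ⊆ Q i ∨ Disjoint (Q i) (Q j)) {c : ι → ℝ≥0}
    (hc : ∀ i ∈ F, c i * ρ (Q i) ≤ τ (Q i)) (t : ℝ≥0) :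
    t * ρ {x | t < finsetMaximal F Q c x} ≤ τ {x | t < finsetMaximal F Q c x} := by
  classical
  have hset : {x | t < finsetMaximal F Q c x} = ⋃ i ∈ F.filter (fun i => t < c i), Q i := by
    ext x
    simp only [finsetMaximal, Set.mem_ofPred_eq, Finset.lt_sup_iff, Set.mem_iUnion,
      Finset.mem_filter, exists_prop]
    refine exists_congr fun i => ?_
    by_cases hx : x ∈ Q i <;> simp [hx]
  rw [hset]
  refine mul_measure_biUnion_le_of_nested ρ τ hQ hnest _ _ fun i hi => ?_
  rw [Finset.mem_filter] at hi
  refine le_trans ?_ (hc i hi.1)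
  gcongr
  exact hi.2.le

theorem lintegral_finsetMaximal_rpow_le {ι α : Type*} [MeasurableSpace α] (ρ τ : Measure α)
    {F : Finset ι} {Q : ι → Set α} (hQ : ∀ i, MeasurableSet (Q i))
    (hnest : ∀ i j, Q i ⊆ Q j ∨ Q j ⊆ Q i ∨ Disjoint (Q i) (Q j)) {c : ι → ℝ≥0}
    (hc : ∀ i ∈ F, c i * ρ (Q i) ≤ τ (Q i)) {q : ℝ} (hq : 1 < q) :
    ∫⁻ x, (finsetMaximal F Q c x : ℝ≥0∞) ^ q ∂ρ ≤
      ENNReal.ofReal (q / (q - 1)) * ∫⁻ x, (finsetMaximal F Q c x : ℝ≥0∞) ^ (q - 1) ∂τ := by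
  have hmeas : Measurable fun x => (finsetMaximal F Q c x : ℝ) :=
    (measurable_finsetMaximal F hQ c).coe_nnreal_real
  have hnn : ∀ x, 0 ≤ (finsetMaximal F Q c x : ℝ) := fun x => NNReal.coe_nonneg _
  have hconv : ∀ (r : ℝ), 0 ≤ r → ∀ x, (finsetMaximal F Q c x : ℝ≥0∞) ^ r =
      ENNReal.ofReal ((finsetMaximal F Q c x : ℝ) ^ r) := by
    intro r hr x
    rw [← ENNReal.ofReal_rpow_of_nonneg (hnn x) hr, ENNReal.ofReal_coe_nnreal]
  simp_rw [hconv q (by linarith), hconv (q - 1) (by linarith)]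
  rw [lintegral_rpow_eq_lintegral_meas_lt_mul ρ (Filter.Eventually.of_forall hnn)
      hmeas.aemeasurable (by linarith : 0 < q),
    lintegral_rpow_eq_lintegral_meas_lt_mul τ (Filter.Eventually.of_forall hnn)
      hmeas.aemeasurable (by linarith : 0 < q - 1), ← mul_assoc,
    ← ENNReal.ofReal_mul (div_nonneg (by linarith) (by linarith)),
    div_mul_cancel₀ _ (by linarith : q - 1 ≠ 0)]
  gcongr ENNReal.ofReal q * ?_
  refine setLIntegral_mono' measurableSet_Ioi fun t ht => ?_
  have ht : 0 < t := ht
  have hw := mul_measure_lt_finsetMaximal_le ρ τ hQ hnest hc t.toNNReal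
  have hset : {x | t.toNNReal < finsetMaximal F Q c x} = {x | t < (finsetMaximal F Q c x : ℝ)} := by
    ext x
    exact Real.toNNReal_lt_iff_lt_coe ht.le
  rw [hset] at hw
  have hpow : ENNReal.ofReal (t ^ (q - 1)) =
      ENNReal.ofReal t * ENNReal.ofReal (t ^ (q - 1 - 1)) := by
    rw [← ENNReal.ofReal_mul ht.le, ← Real.rpow_one_add' ht.le (by linarith)]
    congr 2; ring
  rw [hpow, ← mul_assoc, mul_comm (ρ _)]
  gcongr
  exact hw

theorem lintegral_finsetMaximal_rpow_lt_top {ι α : Type*} [MeasurableSpace α] (ρ : Measure α)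
    {F : Finset ι} {Q : ι → Set α} (hQ : ∀ i, MeasurableSet (Q i))
    (hfin : ∀ i ∈ F, ρ (Q i) < ∞) (c : ι → ℝ≥0) {q : ℝ} (hq : 0 < q) :
    ∫⁻ x, (finsetMaximal F Q c x : ℝ≥0∞) ^ q ∂ρ < ∞ := by
  classical
  have hle : ∀ x, (finsetMaximal F Q c x : ℝ≥0∞) ^ q ≤
      ∑ i ∈ F, (Q i).indicator (fun _ => (c i : ℝ≥0∞) ^ q) x := by
    intro x
    rcases F.eq_empty_or_nonempty with rfl | hne
    · simp [finsetMaximal, hq]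
    obtain ⟨i, hi, hix⟩ := Finset.exists_mem_eq_sup F hne
      (fun i => (Q i).indicator (fun _ => c i) x)
    refine le_trans ?_ (Finset.single_le_sum (fun _ _ => zero_le) hi)
    rw [finsetMaximal, hix]
    by_cases hx : x ∈ Q i <;> simp [hx, hq]
  refine (lintegral_mono hle).trans_lt ?_
  rw [lintegral_finsetSum _ fun i _ => measurable_const.indicator (hQ i)]
  refine ENNReal.sum_lt_top.2 fun i hi => ?_
  rw [lintegral_indicator_const (hQ i)]
  exact ENNReal.mul_lt_top (by finiteness) (hfin i hi)

theorem le_of_le_mul_rpow_conj {I C : ℝ≥0∞} {p p' : ℝ} (hpq : p.HolderConjugate p') (hI : I ≠ ∞)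
    (h : I ≤ C * I ^ (1 / p')) : I ^ (1 / p) ≤ C := by
  rcases eq_or_ne I 0 with h0 | h0
  · rw [h0, ENNReal.zero_rpow_of_pos (one_div_pos.2 hpq.pos)]
    exact zero_le
  have hpos : I ^ (1 / p') ≠ 0 := (ENNReal.rpow_pos (pos_iff_ne_zero.2 h0) hI).ne'
  have htop : I ^ (1 / p') ≠ ∞ :=
    ENNReal.rpow_ne_top_of_nonneg (one_div_pos.2 hpq.symm.pos).le hI
  have hsplit : I = I ^ (1 / p) * I ^ (1 / p') := by
    rw [← ENNReal.rpow_add _ _ h0 hI, one_div, one_div, hpq.inv_add_inv_eq_one,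
      ENNReal.rpow_one]
  rwa [← ENNReal.mul_le_mul_iff_left hpos htop, ← hsplit]

theorem lintegral_finsetMaximal_rpow_le_of_setLIntegral {ι α : Type*} [MeasurableSpace α]
    (ρ : Measure α) {F : Finset ι} {Q : ι → Set α} (hQ : ∀ i, MeasurableSet (Q i))
    (hnest : ∀ i j, Q i ⊆ Q j ∨ Q j ⊆ Q i ∨ Disjoint (Q i) (Q j))
    (hfin : ∀ i ∈ F, ρ (Q i) < ∞) {c : ι → ℝ≥0} {h : α → ℝ≥0∞} (hh : AEMeasurable h ρ)
    (hc : ∀ i ∈ F, c i * ρ (Q i) ≤ ∫⁻ x in Q i, h x ∂ρ) {p q : ℝ} (hpq : p.HolderConjugate q) :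
    (∫⁻ x, (finsetMaximal F Q c x : ℝ≥0∞) ^ p ∂ρ) ^ (1 / p) ≤
      ENNReal.ofReal q * (∫⁻ x, h x ^ p ∂ρ) ^ (1 / p) := by
  have hp := hpq.lt
  have hM : Measurable fun x => (finsetMaximal F Q c x : ℝ≥0∞) :=
    (measurable_finsetMaximal F hQ c).coe_nnreal_ennreal
  set I := ∫⁻ x, (finsetMaximal F Q c x : ℝ≥0∞) ^ p ∂ρ with hI
  have hItop : I < ∞ := lintegral_finsetMaximal_rpow_lt_top ρ hQ hfin c hpq.pos
  have h1 : I ≤ ENNReal.ofReal q * ((∫⁻ x, h x ^ p ∂ρ) ^ (1 / p) * I ^ (1 / q)) := by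
    have h2 := lintegral_finsetMaximal_rpow_le ρ (ρ.withDensity h) hQ hnest (c := c)
      (fun i hi => by rw [withDensity_apply _ (hQ i)]; exact hc i hi) hp
    rw [lintegral_withDensity_eq_lintegral_mul₀ hh (hM.pow_const _).aemeasurable,
      ← hpq.conjugate_eq] at h2
    refine h2.trans ?_
    gcongr
    refine (ENNReal.lintegral_mul_le_Lp_mul_Lq ρ hpq hh (hM.pow_const _).aemeasurable).trans_eq ?_
    simp_rw [← ENNReal.rpow_mul, hpq.sub_one_mul_conj]
    rfl
  refine le_of_le_mul_rpow_conj hpq hItop.ne ?_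
  rw [mul_assoc]
  exact h1

/-- Carleson embedding for a finite nested family with disjoint parts. -/
theorem sum_rpow_mul_measure_le {ι α : Type*} [MeasurableSpace α]
    (ρ : Measure α) {F : Finset ι} {Q E : ι → Set α} (hQ : ∀ i, MeasurableSet (Q i))
    (hnest : ∀ i j, Q i ⊆ Q j ∨ Q j ⊆ Q i ∨ Disjoint (Q i) (Q j))
    (hfin : ∀ i ∈ F, ρ (Q i) < ∞) (hE : ∀ i ∈ F, MeasurableSet (E i))
    (hEQ : ∀ i ∈ F, E i ⊆ Q i) (hdisj : (F : Set ι).PairwiseDisjoint E)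
    {c : ι → ℝ≥0} {h : α → ℝ≥0∞} (hh : AEMeasurable h ρ)
    (hc : ∀ i ∈ F, c i * ρ (Q i) ≤ ∫⁻ x in Q i, h x ∂ρ) {p q : ℝ} (hpq : p.HolderConjugate q) :
    (∑ i ∈ F, (c i : ℝ≥0∞) ^ p * ρ (E i)) ^ (1 / p) ≤
      ENNReal.ofReal q * (∫⁻ x, h x ^ p ∂ρ) ^ (1 / p) := by
  refine le_trans ?_ (lintegral_finsetMaximal_rpow_le_of_setLIntegral ρ hQ hnest hfin hh hc hpq)
  refine ENNReal.rpow_le_rpow ?_ (one_div_pos.2 hpq.pos).le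
  calc ∑ i ∈ F, (c i : ℝ≥0∞) ^ p * ρ (E i)
      ≤ ∑ i ∈ F, ∫⁻ x in E i, (finsetMaximal F Q c x : ℝ≥0∞) ^ p ∂ρ := by
        refine Finset.sum_le_sum fun i hi => ?_
        rw [← setLIntegral_const]
        refine setLIntegral_mono' (hE i hi) fun x hx => ?_
        have := le_finsetMaximal (c := c) hi (hEQ i hi hx)
        exact ENNReal.rpow_le_rpow (by exact_mod_cast this) hpq.pos.le
    _ = ∫⁻ x in ⋃ i ∈ F, E i, (finsetMaximal F Q c x : ℝ≥0∞) ^ p ∂ρ :=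
        (lintegral_biUnion_finset hdisj hE _).symm
    _ ≤ _ := setLIntegral_le_lintegral _ _

theorem bloom_sparse_constant_real {p p' Λ Cμ Cl m s l r V sE lE : ℝ} (hpq : p.HolderConjugate p')
    (hΛ : 0 < Λ) (hCμ : 0 < Cμ) (hCl : 0 < Cl) (hm : 0 < m) (hs : 0 < s) (hl : 0 < l)
    (hr : 0 < r) (hV : 0 < V) (hsE : 0 < sE) (hlE : 0 < lE)
    (h2 : m * s ^ (p - 1) ≤ Cμ * V ^ p) (h3 : l * r ^ (p - 1) ≤ Cl * V ^ p)
    (h4 : V ≤ Λ * (m ^ (1 / p) * sE ^ (1 / p'))) (h5 : V ≤ Λ * (lE ^ (1 / p) * r ^ (1 / p'))) :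
    m ^ (1 / p) * r ^ (1 / p') * s * l ≤
      Λ ^ (p' + p - 2) * Cμ ^ (1 / (p - 1)) * Cl * V ^ 2 * (sE ^ (1 / p) * lE ^ (1 / p')) := by
  have hp := hpq.lt
  have hp1 : 0 < p - 1 := by linarith
  have hp0 : 0 < p := by linarith
  have L := fun {a b : ℝ} (ha : 0 < a) (hab : a ≤ b) => Real.log_le_log ha hab
  have e2 := L (by positivity) h2
  have e3 := L (by positivity) h3
  have e4 := L hV h4
  have e5 := L hV h5
  rw [← Real.log_le_log_iff (by positivity) (by positivity)]
  have lm : ∀ {a b : ℝ}, 0 < a → 0 < b → Real.log (a * b) = Real.log a + Real.log b :=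
    fun ha hb => Real.log_mul ha.ne' hb.ne'
  rw [lm (by positivity) (by positivity), lm (by positivity) (by positivity),
    Real.log_rpow hs, Real.log_rpow hV] at e2
  rw [lm (by positivity) (by positivity), lm (by positivity) (by positivity),
    Real.log_rpow hr, Real.log_rpow hV] at e3
  rw [lm (by positivity) (by positivity), lm (by positivity) (by positivity),
    Real.log_rpow hm, Real.log_rpow hsE] at e4
  rw [lm (by positivity) (by positivity), lm (by positivity) (by positivity),
    Real.log_rpow hlE, Real.log_rpow hr] at e5
  rw [lm (by positivity) hl, lm (by positivity) hs, lm (by positivity) (by positivity),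
    lm (by positivity) (by positivity), lm (by positivity) (by positivity), lm (by positivity) hCl,
    lm (by positivity) (by positivity), lm (by positivity) (by positivity), Real.log_rpow hm,
    Real.log_rpow hr, Real.log_rpow hΛ, Real.log_rpow hCμ, Real.log_rpow hsE, Real.log_rpow hlE,
    Real.log_pow]
  have k2 := mul_le_mul_of_nonneg_left e2 (one_div_pos.2 hp1).le
  have k4 := mul_le_mul_of_nonneg_left e4 (one_div_pos.2 hp1).le
  have k5 := mul_le_mul_of_nonneg_left e5 hp1.le
  have hp' : p' = p / (p - 1) := hpq.conjugate_eq
  have hne : p - 1 ≠ 0 := hp1.ne'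
  rw [hp'] at k4 k5 ⊢
  rw [← sub_nonneg] at k2 e3 k4 k5 ⊢
  refine (add_nonneg (add_nonneg k2 e3) (add_nonneg k4 k5)).trans_eq ?_
  push_cast
  field_simp
  ring

theorem bloom_sparse_constant {p p' Λ Cμ Cl : ℝ} {N m s l r V sE lE : ℝ≥0∞}
    (hpq : p.HolderConjugate p')
    (hΛ : 0 < Λ) (hCμ : 0 < Cμ) (hCl : 0 < Cl) (hm : m ≠ ∞) (hs : s ≠ ∞) (hl : l ≠ ∞)
    (hr : r ≠ ∞) (hV : V ≠ ∞) (hV0 : V ≠ 0) (hsE : sE ≠ ∞) (hlE : lE ≠ ∞)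
    (h1 : N ≤ m ^ (1 / p) * r ^ (1 / p'))
    (h2 : m * s ^ (p - 1) ≤ ENNReal.ofReal Cμ * V ^ p)
    (h3 : l * r ^ (p - 1) ≤ ENNReal.ofReal Cl * V ^ p)
    (h4 : V ≤ ENNReal.ofReal Λ * (m ^ (1 / p) * sE ^ (1 / p')))
    (h5 : V ≤ ENNReal.ofReal Λ * (lE ^ (1 / p) * r ^ (1 / p'))) :
    N * s * l ≤ ENNReal.ofReal (Λ ^ (p' + p - 2) * Cμ ^ (1 / (p - 1)) * Cl) * V ^ 2 *
      (sE ^ (1 / p) * lE ^ (1 / p')) := by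
  have hp1 : 0 < p - 1 := by linarith [hpq.lt]
  have hip : 0 < 1 / p := one_div_pos.2 hpq.pos
  have hiq : 0 < 1 / p' := one_div_pos.2 hpq.symm.pos
  have hp0 := hpq.pos
  refine le_trans (b := m ^ (1 / p) * r ^ (1 / p') * s * l) (by gcongr) ?_
  rcases eq_or_ne s 0 with rfl | hs0
  · simp
  rcases eq_or_ne l 0 with rfl | hl0
  · simp
  have hm0 : m ≠ 0 := by rintro rfl; simp [hV0, hpq.pos] at h4
  have hsE0 : sE ≠ 0 := by rintro rfl; simp [hV0, hpq.symm.pos] at h4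
  have hr0 : r ≠ 0 := by rintro rfl; simp [hV0, hpq.symm.pos] at h5
  have hlE0 : lE ≠ 0 := by rintro rfl; simp [hV0, hpq.pos] at h5
  have fin : ∀ {a : ℝ≥0∞} {x : ℝ}, a ≠ ∞ → 0 < x → a ^ x ≠ ∞ :=
    fun ha hx => ENNReal.rpow_ne_top_of_nonneg hx.le ha
  have t2 := ENNReal.toReal_mono (ENNReal.mul_ne_top ENNReal.ofReal_ne_top (fin hV hp0)) h2
  have t3 := ENNReal.toReal_mono (ENNReal.mul_ne_top ENNReal.ofReal_ne_top (fin hV hp0)) h3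
  have t4 := ENNReal.toReal_mono (ENNReal.mul_ne_top ENNReal.ofReal_ne_top
    (ENNReal.mul_ne_top (fin hm hip) (fin hsE hiq))) h4
  have t5 := ENNReal.toReal_mono (ENNReal.mul_ne_top ENNReal.ofReal_ne_top
    (ENNReal.mul_ne_top (fin hlE hip) (fin hr hiq))) h5
  have hK : 0 ≤ Λ ^ (p' + p - 2) * Cμ ^ (1 / (p - 1)) * Cl := by positivity
  rw [← ENNReal.toReal_le_toReal
    (ENNReal.mul_ne_top (ENNReal.mul_ne_top (ENNReal.mul_ne_top (fin hm hip) (fin hr hiq)) hs) hl)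
    (ENNReal.mul_ne_top (ENNReal.mul_ne_top ENNReal.ofReal_ne_top (ENNReal.pow_ne_top hV))
      (ENNReal.mul_ne_top (fin hsE hip) (fin hlE hiq)))]
  simp only [ENNReal.toReal_mul, ENNReal.toReal_pow, ← ENNReal.toReal_rpow,
    ENNReal.toReal_ofReal hΛ.le, ENNReal.toReal_ofReal hCμ.le, ENNReal.toReal_ofReal hCl.le,
    ENNReal.toReal_ofReal hK] at t2 t3 t4 t5 ⊢
  exact bloom_sparse_constant_real hpq hΛ hCμ hCl (ENNReal.toReal_pos hm0 hm)
    (ENNReal.toReal_pos hs0 hs) (ENNReal.toReal_pos hl0 hl) (ENNReal.toReal_pos hr0 hr)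
    (ENNReal.toReal_pos hV0 hV) (ENNReal.toReal_pos hsE0 hsE) (ENNReal.toReal_pos hlE0 hlE)
    t2 t3 t4 t5

theorem measure_le_rpow_mul_rpow_conj {α : Type*} [MeasurableSpace α] {vol : Measure α} (A : Set α)
    {w : α → ℝ≥0∞} (hw : AEMeasurable w vol) (hw0 : ∀ᵐ x ∂vol, w x ≠ 0)
    (hwt : ∀ᵐ x ∂vol, w x ≠ ∞) {p p' : ℝ} (hpq : p.HolderConjugate p') :
    vol A ≤ (∫⁻ x in A, w x ∂vol) ^ (1 / p) * (∫⁻ x in A, w x ^ (1 - p') ∂vol) ^ (1 / p') := by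
  have hexp : 1 / p + (1 - p') * (1 / p') = 0 := by
    have := hpq.inv_add_inv_eq_one
    have h := hpq.symm.ne_zero
    rw [sub_mul, mul_one_div_cancel h, one_mul, one_div, one_div]
    linarith
  calc vol A = ∫⁻ x in A, 1 ∂vol := by simp
    _ = ∫⁻ x in A, w x ^ (1 / p) * (w x ^ (1 - p')) ^ (1 / p') ∂vol := by
        refine lintegral_congr_ae (ae_restrict_of_ae ?_)
        filter_upwards [hw0, hwt] with x h0 ht
        rw [← ENNReal.rpow_mul, ← ENNReal.rpow_add _ _ h0 ht, hexp, ENNReal.rpow_zero]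
    _ ≤ _ := ENNReal.lintegral_mul_norm_pow_le hw.restrict (hw.restrict.pow_const _)
        (one_div_pos.2 hpq.pos).le (one_div_pos.2 hpq.symm.pos).le
        (by rw [one_div, one_div, hpq.inv_add_inv_eq_one])

theorem lintegral_bloom_weight_le {α : Type*} [MeasurableSpace α] {vol : Measure α} (A : Set α)
    {m l : α → ℝ≥0∞} (hm : AEMeasurable m vol) (hl : AEMeasurable l vol)
    {p p' : ℝ} (hpq : p.HolderConjugate p') :
    ∫⁻ x in A, m x ^ (1 / p) * l x ^ (-(1 / p)) ∂vol ≤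
      (∫⁻ x in A, m x ∂vol) ^ (1 / p) * (∫⁻ x in A, l x ^ (1 - p') ∂vol) ^ (1 / p') := by
  have hexp : (1 - p') * (1 / p') = -(1 / p) := by
    have := hpq.inv_add_inv_eq_one
    have h := hpq.symm.ne_zero
    rw [sub_mul, mul_one_div_cancel h, one_mul, one_div, one_div]
    linarith
  simp_rw [← hexp, ENNReal.rpow_mul]
  exact ENNReal.lintegral_mul_norm_pow_le hm.restrict (hl.restrict.pow_const _)
    (one_div_pos.2 hpq.pos).le (one_div_pos.2 hpq.symm.pos).le
    (by rw [one_div, one_div, hpq.inv_add_inv_eq_one])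

theorem bloom_sparse_cube_le {α : Type*} [MeasurableSpace α] {vol : Measure α} {Q E : Set α}
    (hEQ : E ⊆ Q) {m l : α → ℝ≥0∞} (hm : AEMeasurable m vol) (hl : AEMeasurable l vol)
    (hm0 : ∀ᵐ x ∂vol, m x ≠ 0) (hmt : ∀ᵐ x ∂vol, m x ≠ ∞)
    (hl0 : ∀ᵐ x ∂vol, l x ≠ 0) (hlt : ∀ᵐ x ∂vol, l x ≠ ∞)
    {p p' Λ Cμ Cl : ℝ} (hpq : p.HolderConjugate p')
    (hΛ : 0 < Λ) (hCμ : 0 < Cμ) (hCl : 0 < Cl)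
    (hV0 : vol Q ≠ 0) (hVt : vol Q ≠ ∞) (hVE : vol Q ≤ ENNReal.ofReal Λ * vol E)
    (hmQ : ∫⁻ x in Q, m x ∂vol ≠ ∞) (hsQ : ∫⁻ x in Q, m x ^ (1 - p') ∂vol ≠ ∞)
    (hlQ : ∫⁻ x in Q, l x ∂vol ≠ ∞) (hrQ : ∫⁻ x in Q, l x ^ (1 - p') ∂vol ≠ ∞)
    (hApμ : (∫⁻ x in Q, m x ∂vol) * (∫⁻ x in Q, m x ^ (1 - p') ∂vol) ^ (p - 1) ≤
      ENNReal.ofReal Cμ * vol Q ^ p)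
    (hApl : (∫⁻ x in Q, l x ∂vol) * (∫⁻ x in Q, l x ^ (1 - p') ∂vol) ^ (p - 1) ≤
      ENNReal.ofReal Cl * vol Q ^ p) :
    (∫⁻ x in Q, m x ^ (1 / p) * l x ^ (-(1 / p)) ∂vol) * (∫⁻ x in Q, m x ^ (1 - p') ∂vol) *
        (∫⁻ x in Q, l x ∂vol) ≤
      ENNReal.ofReal (Λ ^ (p' + p - 2) * Cμ ^ (1 / (p - 1)) * Cl) * vol Q ^ 2 *
        ((∫⁻ x in E, m x ^ (1 - p') ∂vol) ^ (1 / p) * (∫⁻ x in E, l x ∂vol) ^ (1 / p')) := by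
  have hip : 0 ≤ 1 / p := (one_div_pos.2 hpq.pos).le
  have hiq : 0 ≤ 1 / p' := (one_div_pos.2 hpq.symm.pos).le
  have mono : ∀ w : α → ℝ≥0∞, ∫⁻ x in E, w x ∂vol ≤ ∫⁻ x in Q, w x ∂vol :=
    fun w => lintegral_mono_set hEQ
  refine bloom_sparse_constant hpq hΛ hCμ hCl hmQ hsQ hlQ hrQ hVt hV0
    (ne_top_of_le_ne_top hsQ (mono _)) (ne_top_of_le_ne_top hlQ (mono _))
    (lintegral_bloom_weight_le Q hm hl hpq) hApμ hApl ?_ ?_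
  · refine hVE.trans ?_
    gcongr
    refine (measure_le_rpow_mul_rpow_conj E hm hm0 hmt hpq).trans ?_
    gcongr
  · refine hVE.trans ?_
    gcongr
    refine (measure_le_rpow_mul_rpow_conj E hl hl0 hlt hpq).trans ?_
    gcongr

/-- The sparse sum over finitely many sets `Q i`, with coefficients built from averages of `u` and
`g`. -/
noncomputable def finsetSparse {ι α : Type*} [MeasurableSpace α] (vol : Measure α) (F : Finset ι)
    (Q : ι → Set α) (u g : α → ℝ≥0∞) (x : α) : ℝ≥0∞ :=
  ∑ i ∈ F, (Q i).indicator (fun _ => (∫⁻ y in Q i, u y ∂vol) / vol (Q i) *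
    ((∫⁻ y in Q i, g y ∂vol) / vol (Q i))) x

theorem measurable_finsetSparse {ι α : Type*} [MeasurableSpace α] (vol : Measure α) (F : Finset ι)
    {Q : ι → Set α} (hQ : ∀ i, MeasurableSet (Q i)) (u g : α → ℝ≥0∞) :
    Measurable (finsetSparse vol F Q u g) :=
  Finset.measurable_fun_sum F fun i _ => measurable_const.indicator (hQ i)

theorem toNNReal_div_mul_cancel {a b : ℝ≥0∞} (ha : a ≠ ∞) (hb : b ≠ ∞) (h : b = 0 → a = 0) :
    ((a / b).toNNReal : ℝ≥0∞) * b = a := by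
  rcases eq_or_ne b 0 with rfl | hb0
  · simp [h rfl]
  · rw [ENNReal.coe_toNNReal (ENNReal.div_ne_top ha hb0), ENNReal.div_mul_cancel hb0 hb]

/-- The bilinear sparse estimate against two Carleson embeddings. -/
theorem lintegral_finsetSparse_rpow_le {ι α : Type*} [MeasurableSpace α] {vol : Measure α}
    {F : Finset ι} {Q E : ι → Set α} (hQ : ∀ i, MeasurableSet (Q i))
    (hnest : ∀ i j, Q i ⊆ Q j ∨ Q j ⊆ Q i ∨ Disjoint (Q i) (Q j))
    (hE : ∀ i ∈ F, MeasurableSet (E i)) (hEQ : ∀ i ∈ F, E i ⊆ Q i)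
    (hdisj : (F : Set ι).PairwiseDisjoint E)
    (hV0 : ∀ i ∈ F, vol (Q i) ≠ 0)
    {ρ σ : Measure α} (hρ : ∀ i ∈ F, ρ (Q i) ≠ ∞) (hσ : ∀ i ∈ F, σ (Q i) ≠ ∞)
    {u g h : α → ℝ≥0∞} (hu : ∀ i ∈ F, ∫⁻ x in Q i, u x ∂vol ≠ ∞)
    {p p' : ℝ} (hpq : p.HolderConjugate p') {K : ℝ≥0∞} (hK : K ≠ 0)
    (hcube : ∀ i ∈ F, (∫⁻ x in Q i, u x ∂vol) * ρ (Q i) * σ (Q i) ≤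
      K * vol (Q i) ^ 2 * (ρ (E i) ^ (1 / p) * σ (E i) ^ (1 / p')))
    (hVt : ∀ i ∈ F, vol (Q i) ≠ ∞)
    (hh : AEMeasurable h ρ) (hgh : ∀ i ∈ F, ∫⁻ x in Q i, h x ∂ρ = ∫⁻ x in Q i, g x ∂vol) :
    (∫⁻ x, finsetSparse vol F Q u g x ^ p ∂σ) ^ (1 / p) ≤
      K * (ENNReal.ofReal p' * ENNReal.ofReal p) * (∫⁻ x, h x ^ p ∂ρ) ^ (1 / p) := by
  have hp1 : 0 < p - 1 := by linarith [hpq.lt]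
  have hip : 0 < 1 / p := one_div_pos.2 hpq.pos
  have hiq : 0 < 1 / p' := one_div_pos.2 hpq.symm.pos
  by_cases hJ : ∫⁻ x, h x ^ p ∂ρ = ∞
  · rw [hJ, ENNReal.top_rpow_of_pos hip, ENNReal.mul_top]
    · exact le_top
    · refine mul_ne_zero hK (mul_ne_zero ?_ ?_)
      · simpa using hpq.symm.pos
      · simpa using hpq.pos
  set A := finsetSparse vol F Q u g with hA
  have hAm : Measurable A := measurable_finsetSparse vol F hQ u g
  have hG : ∀ i ∈ F, ∫⁻ x in Q i, g x ∂vol ≠ ∞ := by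
    intro i hi
    rw [← hgh i hi]
    have hol := ENNReal.lintegral_mul_le_Lp_mul_Lq (ρ.restrict (Q i)) hpq hh.restrict
      (aemeasurable_const (b := (1 : ℝ≥0∞)))
    simp only [Pi.mul_apply, mul_one, ENNReal.one_rpow, lintegral_const, one_mul,
      Measure.restrict_apply_univ] at hol
    refine ne_top_of_le_ne_top (ENNReal.mul_ne_top ?_ ?_) hol
    · exact ENNReal.rpow_ne_top_of_nonneg hip.le
        (ne_top_of_le_ne_top hJ (setLIntegral_le_lintegral _ _))
    · exact ENNReal.rpow_ne_top_of_nonneg hiq.le (hρ i hi)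
  set coef : ι → ℝ≥0∞ := fun i => (∫⁻ y in Q i, u y ∂vol) / vol (Q i) *
    ((∫⁻ y in Q i, g y ∂vol) / vol (Q i)) with hcoef
  have hcoeft : ∀ i ∈ F, coef i ≠ ∞ := fun i hi =>
    ENNReal.mul_ne_top (ENNReal.div_ne_top (hu i hi) (hV0 i hi))
      (ENNReal.div_ne_top (hG i hi) (hV0 i hi))
  have hAB : ∀ x, A x ≤ ∑ i ∈ F, coef i := fun x =>
    Finset.sum_le_sum fun i _ => Set.indicator_le_self' (fun _ _ => zero_le) x
  have hB : ∑ i ∈ F, coef i ≠ ∞ := ENNReal.sum_ne_top.2 hcoeft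
  have hH : ∀ i ∈ F, ∫⁻ x in Q i, A x ^ (p - 1) ∂σ ≠ ∞ := by
    intro i hi
    refine ne_top_of_le_ne_top ?_ (setLIntegral_mono' (hQ i) fun x _ =>
      ENNReal.rpow_le_rpow (hAB x) hp1.le)
    rw [setLIntegral_const]
    exact ENNReal.mul_ne_top (ENNReal.rpow_ne_top_of_nonneg hp1.le hB) (hσ i hi)
  have hI : ∫⁻ x, A x ^ p ∂σ = ∑ i ∈ F, coef i * ∫⁻ x in Q i, A x ^ (p - 1) ∂σ := by
    have hpt : ∀ x, A x ^ p =
        ∑ i ∈ F, coef i * (Q i).indicator (fun y => A y ^ (p - 1)) x := by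
      intro x
      have : A x ^ p = A x * A x ^ (p - 1) := by
        conv_rhs => enter [1]; rw [← ENNReal.rpow_one (A x)]
        rw [← ENNReal.rpow_add_of_nonneg _ _ zero_le_one hp1.le]
        congr 1; ring
      rw [this]
      conv_lhs => enter [1]; rw [hA]
      rw [finsetSparse, Finset.sum_mul]
      refine Finset.sum_congr rfl fun i _ => ?_
      by_cases hx : x ∈ Q i <;> simp [hx, hcoef]
    simp_rw [hpt]
    rw [lintegral_finsetSum _ fun i _ =>
      ((hAm.pow_const _).indicator (hQ i)).const_mul _]
    refine Finset.sum_congr rfl fun i _ => ?_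
    rw [lintegral_const_mul _ ((hAm.pow_const _).indicator (hQ i)), lintegral_indicator (hQ i)]
  have hIt : ∫⁻ x, A x ^ p ∂σ ≠ ∞ := by
    rw [hI]
    exact ENNReal.sum_ne_top.2 fun i hi => ENNReal.mul_ne_top (hcoeft i hi) (hH i hi)
  set a : ι → ℝ≥0 := fun i => ((∫⁻ x in Q i, h x ∂ρ) / ρ (Q i)).toNNReal with ha
  set b : ι → ℝ≥0 := fun i => ((∫⁻ x in Q i, A x ^ (p - 1) ∂σ) / σ (Q i)).toNNReal with hb
  have ha' : ∀ i ∈ F, a i * ρ (Q i) = ∫⁻ x in Q i, h x ∂ρ := fun i hi =>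
    toNNReal_div_mul_cancel (by rw [hgh i hi]; exact hG i hi) (hρ i hi)
      (fun h0 => by rw [setLIntegral_measure_zero _ _ h0])
  have hb' : ∀ i ∈ F, b i * σ (Q i) = ∫⁻ x in Q i, A x ^ (p - 1) ∂σ := fun i hi =>
    toNNReal_div_mul_cancel (hH i hi) (hσ i hi)
      (fun h0 => by rw [setLIntegral_measure_zero _ _ h0])
  have hterm : ∀ i ∈ F, coef i * ∫⁻ x in Q i, A x ^ (p - 1) ∂σ ≤
      K * ((a i * ρ (E i) ^ (1 / p)) * (b i * σ (E i) ^ (1 / p'))) := by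
    intro i hi
    rw [← hb' i hi, hcoef]
    simp only
    rw [← hgh i hi, ← ha' i hi]
    have hVV : vol (Q i) ^ 2 * ((vol (Q i))⁻¹ * (vol (Q i))⁻¹) = 1 := by
      rw [sq, mul_mul_mul_comm, ENNReal.mul_inv_cancel (hV0 i hi) (hVt i hi), one_mul]
    calc (∫⁻ y in Q i, u y ∂vol) / vol (Q i) * (a i * ρ (Q i) / vol (Q i)) * (b i * σ (Q i))
        = ((∫⁻ x in Q i, u x ∂vol) * ρ (Q i) * σ (Q i)) *
            ((a i * b i) * ((vol (Q i))⁻¹ * (vol (Q i))⁻¹)) := by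
          simp only [div_eq_mul_inv]; ring
      _ ≤ (K * vol (Q i) ^ 2 * (ρ (E i) ^ (1 / p) * σ (E i) ^ (1 / p'))) *
            ((a i * b i) * ((vol (Q i))⁻¹ * (vol (Q i))⁻¹)) := by
          gcongr ?_ * _
          exact hcube i hi
      _ = (vol (Q i) ^ 2 * ((vol (Q i))⁻¹ * (vol (Q i))⁻¹)) *
            (K * ((a i * ρ (E i) ^ (1 / p)) * (b i * σ (E i) ^ (1 / p')))) := by ring
      _ = _ := by rw [hVV, one_mul]
  have hpow : ∀ {r : ℝ}, 0 < r → ∀ (c w : ℝ≥0∞), (c * w ^ (1 / r)) ^ r = c ^ r * w := by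
    intro r hr c w
    rw [ENNReal.mul_rpow_of_nonneg _ _ hr.le, ← ENNReal.rpow_mul, one_div_mul_cancel hr.ne',
      ENNReal.rpow_one]
  have hca := sum_rpow_mul_measure_le ρ hQ hnest (fun i hi => (hρ i hi).lt_top) hE hEQ hdisj hh
    (fun i hi => (ha' i hi).le) hpq
  have hcb := sum_rpow_mul_measure_le σ hQ hnest (fun i hi => (hσ i hi).lt_top) hE hEQ hdisj
    (hAm.pow_const (p - 1)).aemeasurable (fun i hi => (hb' i hi).le) hpq.symm
  simp_rw [← ENNReal.rpow_mul, hpq.sub_one_mul_conj] at hcb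
  refine le_of_le_mul_rpow_conj hpq hIt ?_
  calc ∫⁻ x, A x ^ p ∂σ
      ≤ ∑ i ∈ F, K * ((a i * ρ (E i) ^ (1 / p)) * (b i * σ (E i) ^ (1 / p'))) := by
        rw [hI]; exact Finset.sum_le_sum hterm
    _ ≤ K * ((∑ i ∈ F, (a i : ℝ≥0∞) ^ p * ρ (E i)) ^ (1 / p) *
          (∑ i ∈ F, (b i : ℝ≥0∞) ^ p' * σ (E i)) ^ (1 / p')) := by
        rw [← Finset.mul_sum]
        gcongr
        refine (ENNReal.inner_le_Lp_mul_Lq F _ _ hpq).trans_eq ?_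
        simp_rw [hpow hpq.pos, hpow hpq.symm.pos]
    _ ≤ K * ((ENNReal.ofReal p' * (∫⁻ x, h x ^ p ∂ρ) ^ (1 / p)) *
          (ENNReal.ofReal p * (∫⁻ x, A x ^ p ∂σ) ^ (1 / p'))) := by gcongr
    _ = _ := by ring


theorem DyadicCube.toSet_eq_pi_s14 {n : ℕ} (Q : DyadicCube n) :
    Q.toSet = Set.pi Set.univ fun i =>
      Set.Ico ((Q.m i : ℝ) * 2 ^ Q.k) (((Q.m i : ℝ) + 1) * 2 ^ Q.k) := by
  ext x
  simp [DyadicCube.toSet]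

theorem DyadicCube.measurableSet_toSet_s14 {n : ℕ} (Q : DyadicCube n) : MeasurableSet Q.toSet := by
  rw [Q.toSet_eq_pi_s14]
  exact MeasurableSet.univ_pi fun _ => measurableSet_Ico

theorem DyadicCube.volume_toSet {n : ℕ} (Q : DyadicCube n) :
    volume Q.toSet = ENNReal.ofReal (2 ^ Q.k) ^ n := by
  rw [Q.toSet_eq_pi_s14, volume_pi_pi]
  have h : ∀ i, ((Q.m i : ℝ) + 1) * 2 ^ Q.k - (Q.m i : ℝ) * 2 ^ Q.k = 2 ^ Q.k := fun i => by ring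
  simp [Real.volume_Ico, h]

theorem DyadicCube.volume_toSet_ne_zero {n : ℕ} (Q : DyadicCube n) : volume Q.toSet ≠ 0 := by
  rw [Q.volume_toSet]
  have : (0 : ℝ) < 2 ^ Q.k := by positivity
  exact pow_ne_zero _ (by simpa using this)

theorem DyadicCube.volume_toSet_ne_top_s14 {n : ℕ} (Q : DyadicCube n) : volume Q.toSet ≠ ∞ := by
  rw [Q.volume_toSet]
  exact ENNReal.pow_ne_top ENNReal.ofReal_ne_top

theorem DyadicCube.vol_pos {n : ℕ} (Q : DyadicCube n) : 0 < Q.vol :=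
  ENNReal.toReal_pos Q.volume_toSet_ne_zero Q.volume_toSet_ne_top_s14

theorem DyadicCube.ofReal_vol_s14 {n : ℕ} (Q : DyadicCube n) :
    ENNReal.ofReal Q.vol = volume Q.toSet :=
  ENNReal.ofReal_toReal Q.volume_toSet_ne_top_s14

theorem DyadicCube.subset_or_disjoint {n : ℕ} {Q R : DyadicCube n} (h : Q.k ≤ R.k) :
    Q.toSet ⊆ R.toSet ∨ Disjoint Q.toSet R.toSet := by
  by_cases hd : Disjoint Q.toSet R.toSet
  · exact Or.inr hd
  left
  obtain ⟨x, hxQ, hxR⟩ := Set.not_disjoint_iff.1 hd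
  obtain ⟨j, hj⟩ := Int.eq_ofNat_of_zero_le (sub_nonneg.2 h)
  have hk : (2 : ℝ) ^ R.k = 2 ^ j * 2 ^ Q.k := by
    rw [show R.k = (j : ℤ) + Q.k by omega, zpow_add₀ two_ne_zero, zpow_natCast]
  have hpos : (0 : ℝ) < 2 ^ Q.k := by positivity
  intro y hy i
  obtain ⟨hQ1, hQ2⟩ := hxQ i
  obtain ⟨hR1, hR2⟩ := hxR i
  obtain ⟨hy1, hy2⟩ := hy i
  rw [hk, ← mul_assoc] at hR1 hR2 ⊢
  rw [← mul_assoc]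
  have h1 : R.m i * 2 ^ j < Q.m i + 1 := by
    exact_mod_cast lt_of_mul_lt_mul_right (hR1.trans_lt hQ2) hpos.le
  have h2 : Q.m i < (R.m i + 1) * 2 ^ j := by
    exact_mod_cast lt_of_mul_lt_mul_right (hQ1.trans_lt hR2) hpos.le
  have h1' : (R.m i : ℝ) * 2 ^ j ≤ Q.m i := by exact_mod_cast Int.lt_add_one_iff.1 h1
  have h2' : (Q.m i : ℝ) + 1 ≤ (R.m i + 1) * 2 ^ j := by exact_mod_cast Int.add_one_le_iff.2 h2
  exact ⟨(mul_le_mul_of_nonneg_right h1' hpos.le).trans hy1,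
    hy2.trans_le (mul_le_mul_of_nonneg_right h2' hpos.le)⟩

theorem DyadicCube.nested {n : ℕ} (Q R : DyadicCube n) :
    Q.toSet ⊆ R.toSet ∨ R.toSet ⊆ Q.toSet ∨ Disjoint Q.toSet R.toSet := by
  rcases le_total Q.k R.k with h | h
  · rcases subset_or_disjoint h with h | h
    exacts [Or.inl h, Or.inr (Or.inr h)]
  · rcases subset_or_disjoint h with h | h
    exacts [Or.inr (Or.inl h), Or.inr (Or.inr h.symm)]

instance {n : ℕ} : Countable (DyadicCube n) :=
  Function.Injective.countable (f := fun Q : DyadicCube n => (Q.k, Q.m)) fun Q R h => by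
    cases Q
    cases R
    simpa using h

theorem DyadicCube.integrableOn {n : ℕ} (Q : DyadicCube n) {w : (Fin n → ℝ) → ℝ}
    (hw : LocallyIntegrable w volume) : IntegrableOn w Q.toSet := by
  refine (hw.integrableOn_isCompact (isCompact_univ_pi (fun i =>
    isCompact_Icc (a := (Q.m i : ℝ) * 2 ^ Q.k) (b := ((Q.m i : ℝ) + 1) * 2 ^ Q.k)))).mono_set ?_
  rw [Q.toSet_eq_pi_s14]
  exact Set.pi_mono fun i _ => Set.Ico_subset_Icc_self

theorem DyadicCube.setLIntegral_ne_top {n : ℕ} (Q : DyadicCube n) {w : (Fin n → ℝ) → ℝ}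
    (hw : LocallyIntegrable w volume) : ∫⁻ x in Q.toSet, ENNReal.ofReal (w x) ≠ ∞ :=
  ((lintegral_ofReal_le_lintegral_enorm w).trans_lt (Q.integrableOn hw).hasFiniteIntegral).ne

theorem ofReal_davg {n : ℕ} (Q : DyadicCube n) {w : (Fin n → ℝ) → ℝ}
    (hw : LocallyIntegrable w volume) (hw0 : ∀ᵐ x, 0 ≤ w x) :
    ENNReal.ofReal (davg w Q) = (∫⁻ x in Q.toSet, ENNReal.ofReal (w x)) / volume Q.toSet := by
  rw [davg, ENNReal.ofReal_div_of_pos Q.vol_pos, Q.ofReal_vol_s14,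
    ofReal_integral_eq_lintegral_ofReal (Q.integrableOn hw) (ae_restrict_of_ae hw0)]

theorem enorm_davg_le {n : ℕ} (Q : DyadicCube n) (w : (Fin n → ℝ) → ℝ) :
    ‖davg w Q‖ₑ ≤ (∫⁻ x in Q.toSet, ‖w x‖ₑ) / volume Q.toSet := by
  rw [davg, Real.enorm_eq_ofReal_abs, abs_div, abs_of_pos Q.vol_pos,
    ENNReal.ofReal_div_of_pos Q.vol_pos, Q.ofReal_vol_s14, ← Real.enorm_eq_ofReal_abs]
  gcongr
  exact enorm_integral_le_lintegral_enorm _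

theorem ofReal_rpow_ae_eq {n : ℕ} {w : (Fin n → ℝ) → ℝ} (hw : ∀ᵐ x, 0 < w x) (r : ℝ) :
    ∀ᵐ x, ENNReal.ofReal (w x) ^ r = ENNReal.ofReal (w x ^ r) := by
  filter_upwards [hw] with x hx
  exact ENNReal.ofReal_rpow_of_pos hx

theorem setLIntegral_ofReal_rpow {n : ℕ} {w : (Fin n → ℝ) → ℝ} (hw : ∀ᵐ x, 0 < w x) (r : ℝ)
    (A : Set (Fin n → ℝ)) :
    ∫⁻ x in A, ENNReal.ofReal (w x) ^ r = ∫⁻ x in A, ENNReal.ofReal (w x ^ r) :=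
  lintegral_congr_ae (ae_restrict_of_ae (ofReal_rpow_ae_eq hw r))

theorem DyadicCube.muckenhoupt_lintegral_le {n : ℕ} (Q : DyadicCube n) {w : (Fin n → ℝ) → ℝ}
    {p p' C : ℝ} (hp : 1 < p) (hw0 : ∀ᵐ x, 0 < w x) (hw : LocallyIntegrable w volume)
    (hw' : LocallyIntegrable (fun x => w x ^ (1 - p')) volume)
    (hA : davg w Q * (davg (fun x => w x ^ (1 - p')) Q) ^ (p - 1) ≤ C) :
    (∫⁻ x in Q.toSet, ENNReal.ofReal (w x)) *
        (∫⁻ x in Q.toSet, ENNReal.ofReal (w x) ^ (1 - p')) ^ (p - 1) ≤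
      ENNReal.ofReal C * volume Q.toSet ^ p := by
  have hp1 : 0 ≤ p - 1 := by linarith
  have hV0 := Q.volume_toSet_ne_zero
  have hVt := Q.volume_toSet_ne_top_s14
  have hw0' : ∀ᵐ x, 0 ≤ w x := hw0.mono fun x hx => hx.le
  have hs0 : ∀ᵐ x, 0 ≤ w x ^ (1 - p') := hw0.mono fun x hx => Real.rpow_nonneg hx.le _
  have hsnn : 0 ≤ davg (fun x => w x ^ (1 - p')) Q :=
    div_nonneg (integral_nonneg_of_ae (ae_restrict_of_ae hs0)) Q.vol_pos.le
  have h := ENNReal.ofReal_le_ofReal hA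
  rw [ENNReal.ofReal_mul' (Real.rpow_nonneg hsnn _), ← ENNReal.ofReal_rpow_of_nonneg hsnn hp1,
    ofReal_davg Q hw hw0', ofReal_davg Q hw' hs0, ENNReal.div_rpow_of_nonneg _ _ hp1,
    ← setLIntegral_ofReal_rpow hw0] at h
  have hVp : volume Q.toSet ^ p = volume Q.toSet * volume Q.toSet ^ (p - 1) := by
    nth_rewrite 2 [← ENNReal.rpow_one (volume Q.toSet)]
    rw [← ENNReal.rpow_add _ _ hV0 hVt, add_sub_cancel]
  have hVpt : volume Q.toSet ^ (p - 1) ≠ ∞ := ENNReal.rpow_ne_top_of_nonneg hp1 hVt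
  have hVp0 : volume Q.toSet ^ (p - 1) ≠ 0 :=
    (ENNReal.rpow_pos (pos_iff_ne_zero.2 hV0) hVt).ne'
  calc _ = ((∫⁻ x in Q.toSet, ENNReal.ofReal (w x)) / volume Q.toSet *
        ((∫⁻ x in Q.toSet, ENNReal.ofReal (w x) ^ (1 - p')) ^ (p - 1) /
          volume Q.toSet ^ (p - 1))) * volume Q.toSet ^ p := by
        rw [hVp, mul_mul_mul_comm, ENNReal.div_mul_cancel hV0 hVt,
          ENNReal.div_mul_cancel hVp0 hVpt]
    _ ≤ _ := by gcongr

theorem muckenhoupt_const_pos {n : ℕ} {w : (Fin n → ℝ) → ℝ}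
    {p p' C : ℝ} (hpq : p.HolderConjugate p') (hw0 : ∀ᵐ x, 0 < w x)
    (hw : LocallyIntegrable w volume)
    (hw' : LocallyIntegrable (fun x => w x ^ (1 - p')) volume)
    (hA : ∀ Q : DyadicCube n,
      davg w Q * (davg (fun x => w x ^ (1 - p')) Q) ^ (p - 1) ≤ C) : 0 < C := by
  set Q : DyadicCube n := ⟨0, 0⟩
  have h := Q.muckenhoupt_lintegral_le hpq.lt hw0 hw hw' (hA Q)
  have hV := measure_le_rpow_mul_rpow_conj Q.toSet
    hw.aestronglyMeasurable.aemeasurable.ennreal_ofReal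
    (hw0.mono fun x hx => by simpa using hx) (Filter.Eventually.of_forall fun x => by simp) hpq
  have hp0 := hpq.pos
  have hq0 := hpq.symm.pos
  have hp1 := hpq.sub_one_pos
  have hM : ∫⁻ x in Q.toSet, ENNReal.ofReal (w x) ≠ 0 := by
    intro h0
    rw [h0, ENNReal.zero_rpow_of_pos (by positivity), zero_mul] at hV
    exact Q.volume_toSet_ne_zero (le_antisymm hV zero_le)
  have hS : ∫⁻ x in Q.toSet, ENNReal.ofReal (w x) ^ (1 - p') ≠ 0 := by
    intro h0
    rw [h0, ENNReal.zero_rpow_of_pos (by positivity), mul_zero] at hV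
    exact Q.volume_toSet_ne_zero (le_antisymm hV zero_le)
  by_contra hC
  rw [ENNReal.ofReal_of_nonpos (not_lt.1 hC), zero_mul, nonpos_iff_eq_zero, mul_eq_zero] at h
  rcases h with h | h
  · exact hM h
  · exact hS ((ENNReal.rpow_eq_zero_iff_of_pos hp1).1 h)

theorem enorm_bloomSparseOp_le {n : ℕ} (S : Set (DyadicCube n)) (ν f : (Fin n → ℝ) → ℝ)
    {u : (Fin n → ℝ) → ℝ≥0∞} (hu : ∀ᵐ x, ‖ν x‖ₑ = u x) (x : Fin n → ℝ) :
    ‖bloomSparseOp S ν f x‖ₑ ≤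
      ⨆ F : Finset S, finsetSparse volume F (fun Q : S => Q.1.toSet) u (fun y => ‖f y‖ₑ) x := by
  refine (enorm_tsum_le_tsum_enorm).trans ?_
  rw [ENNReal.tsum_eq_iSup_sum]
  refine iSup_mono fun F => Finset.sum_le_sum fun Q _ => ?_
  by_cases hx : x ∈ Q.1.toSet
  · simp only [hx, Set.indicator_of_mem, mul_one, enorm_mul]
    rw [← lintegral_congr_ae (ae_restrict_of_ae hu)]
    exact mul_le_mul' (enorm_davg_le _ _) (enorm_davg_le _ _)
  · simp [hx]

/-- Let `μ, λ ∈ A_p^D` (`1 < p < ∞`) on `ℝⁿ` with dyadic characteristics at most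
`Cμ, Clam`, let `ν = μ^{1/p} λ^{−1/p}`, and let `S` be a `1/Λ`-sparse collection of
dyadic cubes. Then the Bloom sparse operator `A_S^ν` is bounded `L^p(μ) → L^p(λ)` with
norm at most `Λ^{p'+p−2} p p' Cμ^{1/(p−1)} Clam`. -/
theorem stmt14 {n : ℕ} (p p' Λ Cμ Clam : ℝ)
    (hp : 1 < p) (hpp' : 1 / p + 1 / p' = 1) (hΛ : 1 < Λ)
    (S : Set (DyadicCube n)) (E : DyadicCube n → Set (Fin n → ℝ))
    (hEsub : ∀ Q ∈ S, E Q ⊆ Q.toSet)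
    (hEmeas : ∀ Q ∈ S, MeasurableSet (E Q))
    (hEvol : ∀ Q ∈ S, (1 / Λ) * Q.vol ≤ (volume (E Q)).toReal)
    (hEdisj : ∀ Q ∈ S, ∀ R ∈ S, Q ≠ R → Disjoint (E Q) (E R))
    (μ lam : (Fin n → ℝ) → ℝ)
    (hμpos : ∀ᵐ x, 0 < μ x) (hlampos : ∀ᵐ x, 0 < lam x)
    (hμloc : LocallyIntegrable μ volume) (hlamloc : LocallyIntegrable lam volume)
    (hμ'loc : LocallyIntegrable (fun x => μ x ^ (1 - p')) volume)
    (hlam'loc : LocallyIntegrable (fun x => lam x ^ (1 - p')) volume)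
    (hApμ : ∀ Q : DyadicCube n,
      davg μ Q * (davg (fun x => μ x ^ (1 - p')) Q) ^ (p - 1) ≤ Cμ)
    (hAplam : ∀ Q : DyadicCube n,
      davg lam Q * (davg (fun x => lam x ^ (1 - p')) Q) ^ (p - 1) ≤ Clam)
    (f : (Fin n → ℝ) → ℝ) (hf : Measurable f) :
    (∫⁻ x, ENNReal.ofReal (|bloomSparseOp S (fun y => μ y ^ (1 / p) * lam y ^ (-(1 / p))) f x| ^ p
        * lam x)) ^ (1 / p) ≤
      ENNReal.ofReal (Λ ^ (p' + p - 2) * p * p' * Cμ ^ (1 / (p - 1)) * Clam) *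
        (∫⁻ x, ENNReal.ofReal (|f x| ^ p * μ x)) ^ (1 / p) := by
  have hpq : p.HolderConjugate p' :=
    Real.holderConjugate_iff.2 ⟨hp, by rw [← one_div, ← one_div]; exact hpp'⟩
  have hp0 := hpq.pos
  have hq0 := hpq.symm.pos
  have hΛ0 : 0 < Λ := by linarith
  have hCμ := muckenhoupt_const_pos hpq hμpos hμloc hμ'loc hApμ
  have hCl := muckenhoupt_const_pos hpq hlampos hlamloc hlam'loc hAplam
  set m : (Fin n → ℝ) → ℝ≥0∞ := fun x => ENNReal.ofReal (μ x) with hm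
  set l : (Fin n → ℝ) → ℝ≥0∞ := fun x => ENNReal.ofReal (lam x) with hl
  have hmm : AEMeasurable m := hμloc.aestronglyMeasurable.aemeasurable.ennreal_ofReal
  have hlm : AEMeasurable l := hlamloc.aestronglyMeasurable.aemeasurable.ennreal_ofReal
  have hm0 : ∀ᵐ x, m x ≠ 0 := hμpos.mono fun x hx => by simpa [hm] using hx
  have hl0 : ∀ᵐ x, l x ≠ 0 := hlampos.mono fun x hx => by simpa [hl] using hx
  have hmt : ∀ᵐ x, m x ≠ ∞ := Filter.Eventually.of_forall fun x => ENNReal.ofReal_ne_top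
  have hlt : ∀ᵐ x, l x ≠ ∞ := Filter.Eventually.of_forall fun x => ENNReal.ofReal_ne_top
  set g : (Fin n → ℝ) → ℝ≥0∞ := fun x => ‖f x‖ₑ with hg
  have hgm : AEMeasurable g := hf.enorm.aemeasurable
  set u : (Fin n → ℝ) → ℝ≥0∞ := fun x => m x ^ (1 / p) * l x ^ (-(1 / p)) with hu
  set h : (Fin n → ℝ) → ℝ≥0∞ := fun x => g x * m x ^ (p' - 1) with hh
  have hhm : AEMeasurable h := hgm.mul (hmm.pow_const _)
  have hsm : AEMeasurable fun x => m x ^ (1 - p') := hmm.pow_const _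
  set ρ := (volume : Measure (Fin n → ℝ)).withDensity fun x => m x ^ (1 - p') with hρ
  set σ := (volume : Measure (Fin n → ℝ)).withDensity l with hσ
  set K := Λ ^ (p' + p - 2) * Cμ ^ (1 / (p - 1)) * Clam with hK
  have hK0 : 0 < K := by positivity
  have hν : ∀ᵐ x, ‖μ x ^ (1 / p) * lam x ^ (-(1 / p))‖ₑ = u x := by
    filter_upwards [hμpos, hlampos] with x h1 h2
    rw [Real.enorm_of_nonneg (by positivity), ENNReal.ofReal_mul (by positivity),
      ← ENNReal.ofReal_rpow_of_pos h1, ← ENNReal.ofReal_rpow_of_pos h2]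
  have hmQ : ∀ Q : DyadicCube n, ∫⁻ x in Q.toSet, m x ≠ ∞ := fun Q => Q.setLIntegral_ne_top hμloc
  have hlQ : ∀ Q : DyadicCube n, ∫⁻ x in Q.toSet, l x ≠ ∞ :=
    fun Q => Q.setLIntegral_ne_top hlamloc
  have hsQ : ∀ Q : DyadicCube n, ∫⁻ x in Q.toSet, m x ^ (1 - p') ≠ ∞ := fun Q => by
    rw [setLIntegral_ofReal_rpow hμpos]
    exact Q.setLIntegral_ne_top hμ'loc
  have hrQ : ∀ Q : DyadicCube n, ∫⁻ x in Q.toSet, l x ^ (1 - p') ≠ ∞ := fun Q => by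
    rw [setLIntegral_ofReal_rpow hlampos]
    exact Q.setLIntegral_ne_top hlam'loc
  have huQ : ∀ Q : DyadicCube n, ∫⁻ x in Q.toSet, u x ≠ ∞ := fun Q =>
    ne_top_of_le_ne_top (ENNReal.mul_ne_top
      (ENNReal.rpow_ne_top_of_nonneg (by positivity) (hmQ Q))
      (ENNReal.rpow_ne_top_of_nonneg (by positivity) (hrQ Q)))
      (lintegral_bloom_weight_le Q.toSet hmm hlm hpq)
  have hVE : ∀ Q ∈ S, volume Q.toSet ≤ ENNReal.ofReal Λ * volume (E Q) := by
    intro Q hQ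
    have hEt : volume (E Q) ≠ ∞ :=
      ne_top_of_le_ne_top Q.volume_toSet_ne_top_s14 (measure_mono (hEsub Q hQ))
    rw [← ENNReal.ofReal_toReal hEt, ← ENNReal.ofReal_mul hΛ0.le, ← Q.ofReal_vol_s14]
    refine ENNReal.ofReal_le_ofReal ?_
    have := mul_le_mul_of_nonneg_left (hEvol Q hQ) hΛ0.le
    rwa [← mul_assoc, mul_one_div_cancel hΛ0.ne', one_mul] at this
  have hcancel : ∀ᵐ x, m x ^ (1 - p') * h x = g x := by
    filter_upwards [hm0, hmt] with x h0 ht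
    rw [hh]
    simp only
    rw [mul_left_comm, ← ENNReal.rpow_add _ _ h0 ht]
    simp
  have hpow : ∀ᵐ x, m x ^ (1 - p') * h x ^ p = g x ^ p * m x := by
    filter_upwards [hm0, hmt] with x h0 ht
    rw [hh]
    simp only
    rw [ENNReal.mul_rpow_of_nonneg _ _ hp0.le, mul_left_comm, ← ENNReal.rpow_mul,
      ← ENNReal.rpow_add _ _ h0 ht]
    have : 1 - p' + (p' - 1) * p = 1 := by
      have := hpq.mul_eq_add
      linarith
    rw [this, ENNReal.rpow_one]
  have hfinite : ∀ F : Finset S,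
      (∫⁻ x, finsetSparse volume F (fun Q : S => Q.1.toSet) u g x ^ p ∂σ) ^ (1 / p) ≤
        ENNReal.ofReal K * (ENNReal.ofReal p' * ENNReal.ofReal p) *
          (∫⁻ x, h x ^ p ∂ρ) ^ (1 / p) := by
    intro F
    refine lintegral_finsetSparse_rpow_le (E := fun Q : S => E Q.1)
      (fun Q => Q.1.measurableSet_toSet_s14) (fun Q R => Q.1.nested R.1)
      (fun Q _ => hEmeas _ Q.2) (fun Q _ => hEsub _ Q.2)
      (fun Q _ R _ hQR => hEdisj _ Q.2 _ R.2 fun h => hQR (Subtype.ext h))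
      (fun Q _ => Q.1.volume_toSet_ne_zero) (fun Q _ => ?_) (fun Q _ => ?_) (fun Q _ => huQ Q.1)
      hpq (by simpa using hK0) (fun Q _ => ?_) (fun Q _ => Q.1.volume_toSet_ne_top_s14)
      (hhm.mono_ac (withDensity_absolutelyContinuous _ _)) (fun Q _ => ?_)
    · rw [hρ, withDensity_apply _ Q.1.measurableSet_toSet_s14]
      exact hsQ Q.1
    · rw [hσ, withDensity_apply _ Q.1.measurableSet_toSet_s14]
      exact hlQ Q.1
    · rw [hρ, hσ, withDensity_apply _ Q.1.measurableSet_toSet_s14,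
        withDensity_apply _ Q.1.measurableSet_toSet_s14, withDensity_apply _ (hEmeas _ Q.2),
        withDensity_apply _ (hEmeas _ Q.2)]
      exact bloom_sparse_cube_le (hEsub _ Q.2) hmm hlm hm0 hmt hl0 hlt hpq hΛ0 hCμ hCl
        Q.1.volume_toSet_ne_zero Q.1.volume_toSet_ne_top_s14 (hVE _ Q.2) (hmQ _) (hsQ _) (hlQ _)
        (hrQ _) (Q.1.muckenhoupt_lintegral_le hp hμpos hμloc hμ'loc (hApμ _))
        (Q.1.muckenhoupt_lintegral_le hp hlampos hlamloc hlam'loc (hAplam _))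
    · rw [hρ, setLIntegral_withDensity_eq_lintegral_mul₀ hsm hhm Q.1.measurableSet_toSet_s14]
      exact lintegral_congr_ae (ae_restrict_of_ae hcancel)
  have hrhs : ∫⁻ x, h x ^ p ∂ρ = ∫⁻ x, ENNReal.ofReal (|f x| ^ p * μ x) := by
    rw [hρ, lintegral_withDensity_eq_lintegral_mul₀ hsm (hhm.pow_const _)]
    refine lintegral_congr_ae (hpow.mono fun x hx => ?_)
    simp only [Pi.mul_apply]
    rw [hx, ENNReal.ofReal_mul (by positivity), ← ENNReal.ofReal_rpow_of_nonneg (abs_nonneg _) hp0.le,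
      ← Real.enorm_eq_ofReal_abs]
  have hconst : ENNReal.ofReal (Λ ^ (p' + p - 2) * p * p' * Cμ ^ (1 / (p - 1)) * Clam) =
      ENNReal.ofReal K * (ENNReal.ofReal p' * ENNReal.ofReal p) := by
    rw [← ENNReal.ofReal_mul hq0.le, ← ENNReal.ofReal_mul hK0.le]
    congr 1
    rw [hK]; ring
  rw [hconst, ← hrhs]
  set A : Finset S → (Fin n → ℝ) → ℝ≥0∞ :=
    fun F => finsetSparse volume F (fun Q : S => Q.1.toSet) u g with hA
  have hAm : ∀ F, Measurable (A F) := fun F =>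
    measurable_finsetSparse volume F (fun Q => Q.1.measurableSet_toSet_s14) u g
  have hAmono : Monotone A := fun F G hFG x =>
    Finset.sum_le_sum_of_subset hFG
  have hlhs : ∫⁻ x, ENNReal.ofReal
      (|bloomSparseOp S (fun y => μ y ^ (1 / p) * lam y ^ (-(1 / p))) f x| ^ p * lam x) ≤
      ⨆ F, ∫⁻ x, A F x ^ p ∂σ := by
    rw [← lintegral_iSup_directed (fun F => ((hAm F).pow_const p).aemeasurable)
      (Monotone.directed_le fun F G hFG x => ENNReal.rpow_le_rpow (hAmono hFG x) hp0.le), hσ,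
      lintegral_withDensity_eq_lintegral_mul₀ hlm
        (Measurable.iSup fun F => (hAm F).pow_const p).aemeasurable]
    refine lintegral_mono fun x => ?_
    rw [ENNReal.ofReal_mul (by positivity), ← ENNReal.ofReal_rpow_of_nonneg (abs_nonneg _) hp0.le,
      ← Real.enorm_eq_ofReal_abs, Pi.mul_apply, mul_comm]
    gcongr
    have hsup := (ENNReal.orderIsoRpow p hp0).map_iSup fun F => A F x
    simp only [ENNReal.orderIsoRpow_apply] at hsup
    rw [← hsup]
    exact ENNReal.rpow_le_rpow (enorm_bloomSparseOp_le S _ f hν x) hp0.le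
  refine (ENNReal.rpow_le_rpow hlhs (by positivity)).trans ?_
  rw [one_div, ENNReal.rpow_inv_le_iff hp0]
  refine iSup_le fun F => ?_
  rw [← ENNReal.rpow_inv_le_iff hp0, ← one_div]
  exact hfinite F
end
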